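/- Define the four-loop twist-2 ABJM anomalous dimension as the function of N ∈ ℕ given by γ₄(N) = 16·S_{−3} + 16·S₃ − 8·S_{−2,−1} − 8·S_{−2,1} − 16·S_{−1,−2} − 16·S_{−1,2} − 16·S_{1,−2} − 16·S_{1,2} − 8·S_{2,−1} − 8·S_{2,1}, where each nested harmonic sum is evaluated at N. Then γ₄(2n+1) = γ₄(2n) for every natural number n. -/

import Mathlib

/-- Nested (signed) harmonic sum `S_{a₁,…,a_ℓ}(N)`,
`S_{a₁,…,a_ℓ}(N) = Σ_{n=1}^{N} (sign a₁)^n / n^{|a₁|} · S_{a₂,…,a_ℓ}(n)`, with `S_{}(n) = 1`. -/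
noncomputable def nestedS : List ℤ → ℕ → ℝ
  | [], _ => 1
  | a :: b, N => ∑ n ∈ Finset.Icc 1 N, ((Int.sign a : ℝ)) ^ n / (n : ℝ) ^ a.natAbs * nestedS b n

/-- Four-loop twist-2 ABJM (asymptotic) anomalous dimension `γ₄^{ABA}(N)`. -/
noncomputable def gammaFourTwistTwo (N : ℕ) : ℝ :=
  16 * nestedS [-3] N + 16 * nestedS [3] N - 8 * nestedS [-2, -1] N - 8 * nestedS [-2, 1] N - 16 * nestedS [-1, -2] N - 16 * nestedS [-1, 2] N - 16 * nestedS [1, -2] N - 16 * nestedS [1, 2] N - 8 * nestedS [2, -1] N - 8 * nestedS [2, 1] N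

theorem nestedS_cons_succ (a : ℤ) (b : List ℤ) (N : ℕ) :
    nestedS (a :: b) (N + 1) = nestedS (a :: b) N +
      (Int.sign a : ℝ) ^ (N + 1) / ((N + 1 : ℕ) : ℝ) ^ a.natAbs * nestedS b (N + 1) := by
  simp only [nestedS]
  exact Finset.sum_Icc_succ_top (Nat.le_add_left 1 N) _

/-- At odd upper limit, the increments of the sums with leading indices `k` and `-k` cancel. -/
theorem nestedS_neg_add_nestedS_odd (k : ℕ) (b : List ℤ) (n : ℕ) :
    nestedS (-(k : ℤ) :: b) (2 * n + 1) + nestedS ((k : ℤ) :: b) (2 * n + 1) =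
      nestedS (-(k : ℤ) :: b) (2 * n) + nestedS ((k : ℤ) :: b) (2 * n) := by
  have h : (-(Int.sign (k : ℤ) : ℝ)) ^ (2 * n + 1) = -(Int.sign (k : ℤ) : ℝ) ^ (2 * n + 1) :=
    Odd.neg_pow ⟨n, rfl⟩ _
  rw [nestedS_cons_succ, nestedS_cons_succ, Int.sign_neg, Int.natAbs_neg, Int.cast_neg, h]
  ring

/-- Shift symmetry of the four-loop twist-2 ABJM anomalous dimension:
`γ₄^{ABA}(2n+1) = γ₄^{ABA}(2n)`. -/
theorem twist2_four_loop_shift_symmetry (n : ℕ) :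
    gammaFourTwistTwo (2 * n + 1) = gammaFourTwistTwo (2 * n) := by
  have h₃ := nestedS_neg_add_nestedS_odd 3 [] n
  have h₂₁ := nestedS_neg_add_nestedS_odd 2 [-1] n
  have h₂₂ := nestedS_neg_add_nestedS_odd 2 [1] n
  have h₁₁ := nestedS_neg_add_nestedS_odd 1 [-2] n
  have h₁₂ := nestedS_neg_add_nestedS_odd 1 [2] n
  push_cast at h₃ h₂₁ h₂₂ h₁₁ h₁₂
  unfold gammaFourTwistTwo
  linarith
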